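/- Let d ≥ 2 and M ≥ 1 be integers. For every integer k ≥ 1 and every integer t ≥ 0, G(t + M + 1, k) ≤ G(t - M, k). -/

import Mathlib

/-- The vertices of the rooted `d`-ary tree of depth `k`: sequences over `Fin d`
of length at most `k`.  The root is the empty sequence, the children of a vertex
`l` with `l.length < k` are the vertices `l ++ [j]` for `j : Fin d`, and the
leaves are the vertices of length exactly `k`. -/
abbrev Vtx (d k : ℕ) : Type := {l : List (Fin d) // l.length ≤ k}

/-- The root `v₀` of the tree. -/
def rootV (d k : ℕ) : Vtx d k := ⟨[], by simp⟩

/-- `L_M(d,k)`: the set of integer-valued `M`-Lipschitz functions on the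
`d`-ary tree of depth `k` that vanish on all leaves. -/
def LM (d k M : ℕ) : Set (Vtx d k → ℤ) :=
  {f | (∀ v : Vtx d k, v.1.length = k → f v = 0) ∧
       (∀ (l : List (Fin d)) (hl : l.length + 1 ≤ k) (j : Fin d),
         |f ⟨l ++ [j], by simpa using hl⟩ - f ⟨l, Nat.le_of_succ_le hl⟩| ≤ (M : ℤ))}

/-- `G(t,k)`: the number of functions in `L_M(d,k)` whose value at the root is `t`. -/
noncomputable def G (d k M : ℕ) (t : ℤ) : ℕ :=
  Nat.card {f : Vtx d k → ℤ // f ∈ LM d k M ∧ f (rootV d k) = t}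

/-- The probability that a uniformly random element of `L_M(d,k)` takes the
value `t` at the root. -/
noncomputable def PrRoot (d k M : ℕ) (t : ℤ) : ℝ :=
  (G d k M t : ℝ) / (Nat.card (LM d k M) : ℝ)

/-- The function on the tree of depth `k + 1` with value `t` at the root and restriction `g j` to
the subtree below the `j`-th child of the root. -/
def glue {d k : ℕ} (t : ℤ) (g : Fin d → Vtx d k → ℤ) : Vtx d (k + 1) → ℤ
  | ⟨[], _⟩ => t
  | ⟨j :: l, h⟩ => g j ⟨l, by simpa using h⟩

/-- The restriction of a function to the subtree below the `j`-th child of the root. -/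
def restrict {d k : ℕ} (f : Vtx d (k + 1) → ℤ) (j : Fin d) : Vtx d k → ℤ :=
  fun v => f ⟨j :: v.1, by simpa using v.2⟩

theorem glue_mem_LM {d k M : ℕ} {t : ℤ} {g : Fin d → Vtx d k → ℤ}
    (hg : ∀ j, g j ∈ LM d k M) (ht : ∀ j, |g j (rootV d k) - t| ≤ M) :
    glue t g ∈ LM d (k + 1) M := by
  refine ⟨?_, ?_⟩
  · rintro ⟨_ | ⟨j, l⟩, h⟩ hv
    · simp at hv
    · exact (hg j).1 _ (by simpa using hv)
  · rintro (_ | ⟨j, l⟩) hl i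
    · exact ht i
    · exact (hg j).2 l (by simpa using hl) i

theorem restrict_mem_LM {d k M : ℕ} {f : Vtx d (k + 1) → ℤ} (hf : f ∈ LM d (k + 1) M)
    (j : Fin d) : restrict f j ∈ LM d k M := by
  refine ⟨fun v hv => hf.1 _ (by simpa using hv), fun l hl i => ?_⟩
  exact hf.2 (j :: l) (by simpa using hl) i

/-- A Lipschitz function on the tree of depth `k + 1` with value `t` at the root amounts to a
family, indexed by the children of the root, of Lipschitz functions on the tree of depth `k`. -/
def rootFiberEquiv (d k M : ℕ) (t : ℤ) :
    {f : Vtx d (k + 1) → ℤ // f ∈ LM d (k + 1) M ∧ f (rootV d (k + 1)) = t} ≃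
      (Fin d → {g : Vtx d k → ℤ // g ∈ LM d k M ∧ |g (rootV d k) - t| ≤ M}) where
  toFun f j := ⟨restrict f.1 j, restrict_mem_LM f.2.1 j, by
    have h := f.2.1.2 [] (by simp) j
    have h0 : f.1 ⟨[], Nat.zero_le _⟩ = t := f.2.2
    rw [h0] at h
    exact h⟩
  invFun g := ⟨glue t fun j => (g j).1,
    glue_mem_LM (fun j => (g j).2.1) (fun j => (g j).2.2), rfl⟩
  left_inv f := by
    apply Subtype.ext
    funext v
    obtain ⟨_ | ⟨j, l⟩, h⟩ := v
    · exact f.2.2.symm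
    · rfl
  right_inv g := rfl

/-- Functions whose root value is within `M` of `t`, sorted by that value. -/
def rootWindowEquiv (d k M : ℕ) (t : ℤ) :
    {g : Vtx d k → ℤ // g ∈ LM d k M ∧ |g (rootV d k) - t| ≤ M} ≃
      Σ s : Finset.Icc (t - M) (t + M),
        {g : Vtx d k → ℤ // g ∈ LM d k M ∧ g (rootV d k) = s} where
  toFun g := ⟨⟨g.1 (rootV d k), by
    have h := abs_le.mp g.2.2
    exact Finset.mem_Icc.mpr ⟨by linarith, by linarith⟩⟩, g.1, g.2.1, rfl⟩
  invFun p := ⟨p.2.1, p.2.2.1, by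
    have h := Finset.mem_Icc.mp p.1.2
    rw [p.2.2.2]
    exact abs_le.mpr ⟨by linarith, by linarith⟩⟩
  left_inv g := rfl
  right_inv := by
    rintro ⟨⟨s, hs⟩, g, hg, h⟩
    have h' : g (rootV d k) = s := h
    subst h'
    rfl

theorem finite_rootFiber (d k M : ℕ) (t : ℤ) :
    Finite {f : Vtx d k → ℤ // f ∈ LM d k M ∧ f (rootV d k) = t} := by
  induction k generalizing t with
  | zero =>
    have : Subsingleton {f : Vtx d 0 → ℤ // f ∈ LM d 0 M ∧ f (rootV d 0) = t} := by
      refine ⟨fun f g => Subtype.ext (funext fun v => ?_)⟩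
      have hv : v.1.length = 0 := Nat.le_zero.mp v.2
      rw [f.2.1.1 v hv, g.2.1.1 v hv]
    infer_instance
  | succ k ih =>
    have (s : ℤ) := ih s
    have := Finite.of_equiv _ (rootWindowEquiv d k M t).symm
    exact Finite.of_equiv _ (rootFiberEquiv d k M t).symm

theorem G_succ (d k M : ℕ) (t : ℤ) :
    G d (k + 1) M t = (∑ s ∈ Finset.Icc (t - M) (t + M), G d k M s) ^ d := by
  have (s : ℤ) := finite_rootFiber d k M s
  rw [G, Nat.card_congr (rootFiberEquiv d k M t), Nat.card_fun, Nat.card_fin,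
    Nat.card_congr (rootWindowEquiv d k M t), Nat.card_sigma]
  exact congrArg (· ^ d) (Finset.sum_coe_sort _ (G d k M))

theorem G_zero_eq_zero (d M : ℕ) {t : ℤ} (ht : t ≠ 0) : G d 0 M t = 0 := by
  have : IsEmpty {f : Vtx d 0 → ℤ // f ∈ LM d 0 M ∧ f (rootV d 0) = t} :=
    ⟨fun f => ht (f.2.2.symm.trans (f.2.1.1 _ rfl))⟩
  exact Nat.card_of_isEmpty

/-- Sums over a window of fixed width of a symmetric unimodal function are again symmetric and
unimodal in the centre of the window. -/
theorem sum_Icc_le_sum_Icc_of_abs_le {g : ℤ → ℕ} (hg : ∀ a b : ℤ, |a| ≤ |b| → g b ≤ g a)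
    (M : ℕ) {a b : ℤ} (hab : |a| ≤ |b|) :
    ∑ s ∈ Finset.Icc (b - M) (b + M), g s ≤ ∑ s ∈ Finset.Icc (a - M) (a + M), g s := by
  set S : ℤ → ℕ := fun t => ∑ s ∈ Finset.Icc (t - M) (t + M), g s with hS
  have hneg (t : ℤ) : S (-t) = S t := by
    refine Finset.sum_nbij' (fun s => -s) (fun s => -s) ?_ ?_ (by simp) (by simp) ?_
    · intro s hs
      simp only [Finset.mem_Icc] at hs ⊢
      constructor <;> linarith
    · intro s hs
      simp only [Finset.mem_Icc] at hs ⊢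
      constructor <;> linarith
    · intro s _
      exact le_antisymm (hg _ _ (abs_neg s).le) (hg _ _ (abs_neg s).ge)
  have habs (t : ℤ) : S |t| = S t := by
    rcases abs_choice t with h | h <;> rw [h]
    exact hneg t
  have hstep (n : ℕ) : S ((n + 1 : ℕ) : ℤ) ≤ S n := by
    have h1 : Finset.Icc ((n : ℤ) - M) (n + M) =
        insert ((n : ℤ) - M) (Finset.Icc ((n : ℤ) - M + 1) (n + M)) := by
      ext s
      simp only [Finset.mem_Icc, Finset.mem_insert]
      omega
    have h2 : Finset.Icc (((n + 1 : ℕ) : ℤ) - M) ((n + 1 : ℕ) + M) =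
        insert ((n : ℤ) + M + 1) (Finset.Icc ((n : ℤ) - M + 1) (n + M)) := by
      ext s
      simp only [Finset.mem_Icc, Finset.mem_insert]
      omega
    simp only [hS]
    rw [h1, h2, Finset.sum_insert (by simp), Finset.sum_insert (by simp)]
    refine Nat.add_le_add_right (hg _ _ ?_) _
    rw [Int.abs_eq_natAbs, Int.abs_eq_natAbs]
    omega
  have hanti : Antitone fun n : ℕ => S n := antitone_nat_of_succ_le hstep
  change S b ≤ S a
  rw [Int.abs_eq_natAbs, Int.abs_eq_natAbs] at hab
  rw [← habs a, ← habs b, Int.abs_eq_natAbs, Int.abs_eq_natAbs]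
  exact hanti (by omega)

/-- The number of Lipschitz functions with root value `t` is nonincreasing in `|t|`. -/
theorem G_le_G_of_abs_le (d k M : ℕ) {a b : ℤ} (hab : |a| ≤ |b|) :
    G d k M b ≤ G d k M a := by
  induction k generalizing a b with
  | zero =>
    rcases eq_or_ne b 0 with rfl | hb
    · rw [abs_zero, abs_nonpos_iff] at hab
      rw [hab]
    · simp [G_zero_eq_zero d M hb]
  | succ k ih =>
    rw [G_succ, G_succ]
    exact Nat.pow_le_pow_left (sum_Icc_le_sum_Icc_of_abs_le (fun _ _ h => ih h) M hab) d

/-- For every `k ≥ 1` and every integer `t ≥ 0`, `G(t+M+1,k) ≤ G(t-M,k)`. -/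
theorem G_shift_le (d M : ℕ) (hd : 2 ≤ d) (hM : 1 ≤ M) (k : ℕ) (hk : 1 ≤ k)
    (t : ℤ) (ht : 0 ≤ t) :
    G d k M (t + M + 1) ≤ G d k M (t - M) := by
  refine G_le_G_of_abs_le d k M ?_
  rw [Int.abs_eq_natAbs, Int.abs_eq_natAbs]
  omega
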